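/- If $M_1,\dots,M_d$ are pairwise commuting Hermitian $n\times n$ matrices, then the Clifford spectrum $\Lambda(M_1,\dots,M_d)$ equals the joint spectrum: the set of $\lambda\in\mathbb{R}^d$ for which there exists a nonzero vector $v$ with $M_j v = \lambda_j v$ for all $j$. -/

import Mathlib

open Matrix
open scoped Kronecker

/-- for pairwise commuting Hermitian matrices, the Clifford spectrum is the
joint spectrum: the localizer at `λ` is singular iff there is a nonzero joint eigenvector
with eigenvalues `λⱼ`. -/
theorem cliffordSpectrum_eq_jointSpectrum {n d m : ℕ} (hm : 0 < m)
    (M : Fin d → Matrix (Fin n) (Fin n) ℂ) (hM : ∀ j, (M j).IsHermitian)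
    (hcomm : ∀ j k, M j * M k = M k * M j)
    (Γ : Fin d → Matrix (Fin m) (Fin m) ℂ)
    (hΓherm : ∀ j, (Γ j).IsHermitian) (hΓsq : ∀ j, Γ j * Γ j = 1)
    (hΓanti : ∀ j k, j ≠ k → Γ j * Γ k = -(Γ k * Γ j))
    (lam : Fin d → ℝ) :
    ¬ IsUnit (∑ j, (M j - (lam j : ℂ) • 1) ⊗ₖ Γ j) ↔
      ∃ v : Fin n → ℂ, v ≠ 0 ∧ ∀ j, (M j) *ᵥ v = (lam j : ℂ) • v := by
  classical
  set A : Fin d → Matrix (Fin n) (Fin n) ℂ := fun j => M j - (lam j : ℂ) • 1 with hA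
  have hAv : ∀ j (v : Fin n → ℂ), A j *ᵥ v = 0 ↔ M j *ᵥ v = (lam j : ℂ) • v := by
    intro j v
    simp only [hA, Matrix.sub_mulVec, Matrix.smul_mulVec, Matrix.one_mulVec, sub_eq_zero]
  have hAh : ∀ j, (A j)ᴴ = A j := by
    intro j
    simp [hA, Matrix.conjTranspose_sub, Matrix.conjTranspose_smul, (hM j).eq]
  have hAc : ∀ j k, A j * A k = A k * A j := by
    intro j k
    simp only [hA, sub_mul, mul_sub, hcomm j k, Matrix.smul_mul, Matrix.mul_smul, one_mul, mul_one,
      smul_comm (lam j : ℂ) (lam k : ℂ)]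
    abel
  change ¬ IsUnit (∑ j, A j ⊗ₖ Γ j) ↔ _
  simp only [← hAv]
  set L := ∑ j, A j ⊗ₖ Γ j with hL
  have hLL : L * L = (∑ j, A j * A j) ⊗ₖ (1 : Matrix (Fin m) (Fin m) ℂ) := by
    have h1 : L * L = ∑ j, ∑ k, (A j * A k) ⊗ₖ (Γ j * Γ k) := by
      simp only [hL, Finset.sum_mul_sum, Matrix.mul_kronecker_mul]
    have h2 : L * L = ∑ j, ∑ k, (A j * A k) ⊗ₖ (Γ k * Γ j) := by
      rw [h1, Finset.sum_comm]
      refine Finset.sum_congr rfl fun j _ => Finset.sum_congr rfl fun k _ => ?_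
      rw [hAc]
    have h3 : L * L + L * L = ∑ j, ((A j * A j) ⊗ₖ (1 : Matrix (Fin m) (Fin m) ℂ) +
        (A j * A j) ⊗ₖ (1 : Matrix (Fin m) (Fin m) ℂ)) := by
      nth_rewrite 1 [h1]
      rw [h2, ← Finset.sum_add_distrib]
      refine Finset.sum_congr rfl fun j _ => ?_
      rw [← Finset.sum_add_distrib, Finset.sum_eq_single j]
      · rw [hΓsq]
      · intro k _ hk
        rw [← Matrix.kronecker_add, hΓanti k j hk, add_neg_cancel, Matrix.kronecker_zero]
      · simp
    have h4 : (∑ j, A j * A j) ⊗ₖ (1 : Matrix (Fin m) (Fin m) ℂ) =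
        ∑ j, (A j * A j) ⊗ₖ (1 : Matrix (Fin m) (Fin m) ℂ) := by
      ext p q
      simp [Matrix.kroneckerMap_apply, Matrix.sum_apply, Finset.sum_mul]
    rw [Finset.sum_add_distrib, ← h4, ← two_smul ℂ, ← two_smul ℂ] at h3
    exact smul_right_injective _ (two_ne_zero : (2 : ℂ) ≠ 0) h3
  constructor
  · intro hLu
    have hS : ¬ IsUnit (∑ j, A j * A j) := by
      intro hS
      apply hLu
      obtain ⟨B, hB⟩ := hS.exists_right_inv
      have h5 : L * (L * (B ⊗ₖ (1 : Matrix (Fin m) (Fin m) ℂ))) = 1 := by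
        rw [← mul_assoc, hLL, ← Matrix.mul_kronecker_mul, hB, one_mul, Matrix.one_kronecker_one]
      exact IsUnit.of_mul_eq_one _ h5
    rw [Matrix.isUnit_iff_isUnit_det, isUnit_iff_ne_zero, not_not] at hS
    obtain ⟨v, hv, hSv⟩ := Matrix.exists_mulVec_eq_zero_iff.mpr hS
    refine ⟨v, hv, fun j => ?_⟩
    have h6 : ∑ j, star (A j *ᵥ v) ⬝ᵥ (A j *ᵥ v) = 0 := by
      have : star v ⬝ᵥ ((∑ j, A j * A j) *ᵥ v) = 0 := by rw [hSv, dotProduct_zero]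
      rw [Matrix.sum_mulVec, dotProduct_sum] at this
      rw [← this]
      refine Finset.sum_congr rfl fun j _ => ?_
      rw [Matrix.star_mulVec, hAh, ← Matrix.dotProduct_mulVec, Matrix.mulVec_mulVec]
    open scoped ComplexOrder in
    have h7 := (Finset.sum_eq_zero_iff_of_nonneg
      (fun j _ => dotProduct_star_self_nonneg (A j *ᵥ v))).mp h6 j (Finset.mem_univ j)
    open scoped ComplexOrder in
    exact dotProduct_star_self_eq_zero.mp h7
  · rintro ⟨v, hv, hAv0⟩ hLu
    apply hv
    have h8 : L * (Matrix.replicateCol Unit v ⊗ₖ (1 : Matrix (Fin m) (Fin m) ℂ)) = 0 := by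
      rw [hL, Matrix.sum_mul]
      refine Finset.sum_eq_zero fun j _ => ?_
      rw [← Matrix.mul_kronecker_mul, ← Matrix.replicateCol_mulVec, hAv0 j]
      simp
    obtain ⟨B, hB⟩ := hLu.exists_left_inv
    have h9 : Matrix.replicateCol Unit v ⊗ₖ (1 : Matrix (Fin m) (Fin m) ℂ) = 0 := by
      have := congrArg (B * ·) h8
      simpa [← Matrix.mul_assoc, hB] using this
    funext i
    have := congrFun (congrFun h9 (i, ⟨0, hm⟩)) ((), ⟨0, hm⟩)
    simpa [Matrix.kroneckerMap_apply] using this
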